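/- arXiv:2201.01612 — 2 statements merged into one kernel-verified Lean document; each statement's English description precedes it below -/
import Mathlib

section
/- Let B = A^{coH} ⊆ A be an H-Hopf–Galois extension in which H and A carry ℤⁿ×ℤⁿ-gradings satisfying conditions (i)–(iv) for H and the compatibility conditions for A. Then for every homogeneous h ∈ H_{(r,l)}, the translation map value τ(h) ∈ A⊗_B A lies in the image, under the quotient map A⊗A → A⊗_B A, of the subspace ⊕_{p∈ℤⁿ} A_{(−p,−r)} ⊗ A_{(p,l)}; i.e., there are representatives τ(h) = Σ h^⟨1⟩ ⊗_B h^⟨2⟩ with deg h^⟨1⟩ = (−p,−r) and deg h^⟨2⟩ = (p,l). -/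
/- Statement 11 (Scenario II): In a bigraded Hopf--Galois extension, for homogeneous
h ∈ H_{(r,l)} the translation map value τ(h) ∈ A ⊗_B A lies in the image of the
subspace ⊕_p A_{(-p,-r)} ⊗ A_{(p,l)} under the quotient map A ⊗ A → A ⊗_B A. -/

open TensorProduct DirectSum

noncomputable section

variable {H A : Type} [Ring H] [HopfAlgebra ℂ H] [Ring A] [Algebra ℂ A]

/-- The coinvariant subspace `B = A^{co H}`. -/
def coinv (δ : A →ₐ[ℂ] A ⊗[ℂ] H) : Set A := {a | δ a = a ⊗ₜ[ℂ] (1 : H)}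

/-- The relation submodule defining the balanced tensor product `A ⊗_B A`. -/
def galRel (δ : A →ₐ[ℂ] A ⊗[ℂ] H) : Submodule ℂ (A ⊗[ℂ] A) :=
  Submodule.span ℂ
    {x | ∃ (a a' b : A), b ∈ coinv δ ∧ x = (a * b) ⊗ₜ[ℂ] a' - a ⊗ₜ[ℂ] (b * a')}

/-- The (unbalanced) canonical Galois map `ã ⊗ a ↦ ã a₍₀₎ ⊗ a₍₁₎`. -/
def chi0 (δ : A →ₐ[ℂ] A ⊗[ℂ] H) : A ⊗[ℂ] A →ₗ[ℂ] A ⊗[ℂ] H :=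
  (TensorProduct.map (LinearMap.mul' ℂ A) LinearMap.id) ∘ₗ
    ((TensorProduct.assoc ℂ A A H).symm.toLinearMap) ∘ₗ
      (TensorProduct.map LinearMap.id δ.toLinearMap)

section GradedTensor

variable {ι κ D M N : Type*} [DecidableEq ι] [DecidableEq κ]
  [AddCommGroup M] [Module ℂ M] [AddCommGroup N] [Module ℂ N]

/-- A tensor product of graded modules is generated by tensors of homogeneous elements. -/
theorem TensorProduct.homogeneous_induction
    (ℳ : ι → Submodule ℂ M) [DirectSum.Decomposition ℳ]
    (𝒩 : κ → Submodule ℂ N) [DirectSum.Decomposition 𝒩]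
    {motive : M ⊗[ℂ] N → Prop} (zero : motive 0)
    (tmul : ∀ i j, ∀ m ∈ ℳ i, ∀ k ∈ 𝒩 j, motive (m ⊗ₜ k))
    (add : ∀ x y, motive x → motive y → motive (x + y)) (x : M ⊗[ℂ] N) : motive x := by
  induction x with
  | zero => exact zero
  | add x y hx hy => exact add x y hx hy
  | tmul m k =>
    induction m using DirectSum.Decomposition.inductionOn ℳ with
    | zero => simpa using zero
    | add m m' hm hm' => simpa [TensorProduct.add_tmul] using add _ _ hm hm'
    | homogeneous m =>
      induction k using DirectSum.Decomposition.inductionOn 𝒩 with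
      | zero => simpa using zero
      | add k k' hk hk' => simpa [TensorProduct.tmul_add] using add _ _ hk hk'
      | homogeneous k => exact tmul _ _ m m.2 k k.2

/-- For graded modules `M`, `N` and a degree function on pairs of degrees, the linear map
sending a tensor to the family of its components of each total degree. -/
def degreeComponents (ℳ : ι → Submodule ℂ M) [DirectSum.Decomposition ℳ]
    (𝒩 : κ → Submodule ℂ N) [DirectSum.Decomposition 𝒩] (deg : ι → κ → D) :
    M ⊗[ℂ] N →ₗ[ℂ] D →₀ M ⊗[ℂ] N :=
  DirectSum.toModule ℂ (ι × κ) (D →₀ M ⊗[ℂ] N)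
      (fun ij => Finsupp.lsingle (deg ij.1 ij.2) ∘ₗ
        TensorProduct.map (ℳ ij.1).subtype (𝒩 ij.2).subtype) ∘ₗ
    (TensorProduct.directSum ℂ ℂ (fun i => ℳ i) (fun j => 𝒩 j)).toLinearMap ∘ₗ
      TensorProduct.map (DirectSum.decomposeLinearEquiv ℳ).toLinearMap
        (DirectSum.decomposeLinearEquiv 𝒩).toLinearMap

theorem degreeComponents_tmul (ℳ : ι → Submodule ℂ M) [DirectSum.Decomposition ℳ]
    (𝒩 : κ → Submodule ℂ N) [DirectSum.Decomposition 𝒩] (deg : ι → κ → D)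
    {i : ι} {j : κ} {m : M} {k : N} (hm : m ∈ ℳ i) (hk : k ∈ 𝒩 j) :
    degreeComponents ℳ 𝒩 deg (m ⊗ₜ k) = Finsupp.single (deg i j) (m ⊗ₜ k) := by
  lift m to ℳ i using hm
  lift k to 𝒩 j using hk
  simp only [degreeComponents, LinearMap.comp_apply, TensorProduct.map_tmul,
    LinearEquiv.coe_coe, DirectSum.decomposeLinearEquiv_apply, DirectSum.decompose_coe]
  rw [← DirectSum.lof_eq_of ℂ, ← DirectSum.lof_eq_of ℂ,
    TensorProduct.directSum_lof_tmul_lof, DirectSum.toModule_lof]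
  simp

end GradedTensor

theorem chi0_tmul (δ : A →ₐ[ℂ] A ⊗[ℂ] H) (a a' : A) :
    chi0 δ (a ⊗ₜ a') = (LinearMap.mulLeft ℂ a).rTensor H (δ a') := by
  have key : ∀ y : A ⊗[ℂ] H, TensorProduct.map (LinearMap.mul' ℂ A) LinearMap.id
      ((TensorProduct.assoc ℂ A A H).symm (a ⊗ₜ y)) =
        (LinearMap.mulLeft ℂ a).rTensor H y := by
    intro y
    induction y with
    | zero => simp
    | tmul b h => simp
    | add x y hx hy => simp [TensorProduct.tmul_add, hx, hy]
  simpa [chi0] using key (δ a')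

/-- The canonical map sends `A_{(a,b)} ⊗ A_{(c,d)}` into the sum of the
`A_{(u,v)} ⊗ H_{(s,d)}` with `u = a + c` and `v - s = b`. -/
theorem degreeComponents_chi0_tmul {G : Type*} [AddCommGroup G] [DecidableEq G]
    (ℋ : G × G → Submodule ℂ H) [GradedAlgebra ℋ]
    (𝒜 : G × G → Submodule ℂ A) [GradedAlgebra 𝒜] (δ : A →ₐ[ℂ] A ⊗[ℂ] H)
    (hδgrad : ∀ (r l : G), ∀ a ∈ 𝒜 (r, l), δ a ∈ ⨆ s : G,
      LinearMap.range (TensorProduct.map (𝒜 (r, s)).subtype (ℋ (s, l)).subtype))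
    {i j : G × G} {a a' : A} (ha : a ∈ 𝒜 i) (ha' : a' ∈ 𝒜 j) :
    degreeComponents 𝒜 ℋ (fun i j => (i.1, i.2 - j.1, j.2)) (chi0 δ (a ⊗ₜ a')) =
      Finsupp.single (i.1 + j.1, i.2, j.2) (chi0 δ (a ⊗ₜ a')) := by
  rw [chi0_tmul]
  have hmem := hδgrad j.1 j.2 a' ha'
  generalize δ a' = x at hmem
  induction hmem using Submodule.iSup_induction' with
  | zero => simp
  | add x y _ _ hx hy => simp only [map_add, hx, hy, Finsupp.single_add]
  | mem s x hx =>
    obtain ⟨y, rfl⟩ := hx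
    induction y with
    | zero => simp
    | add x y hx hy => simp only [map_add, hx, hy, Finsupp.single_add]
    | tmul b h =>
      have hb : a * (b : A) ∈ 𝒜 (i + (j.1, s)) := SetLike.mul_mem_graded ha b.2
      simp only [TensorProduct.map_tmul, Submodule.subtype_apply, LinearMap.rTensor_tmul,
        LinearMap.mulLeft_apply]
      rw [degreeComponents_tmul 𝒜 ℋ _ hb h.2]
      simp

theorem translation_map_bidegree {n : ℕ}
    (ℋ : (Fin n → ℤ) × (Fin n → ℤ) → Submodule ℂ H) [GradedAlgebra ℋ]
    (𝒜 : (Fin n → ℤ) × (Fin n → ℤ) → Submodule ℂ A) [GradedAlgebra 𝒜]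
    -- (ii) the coproduct of `H` is compatible with the bigrading
    (hΔ : ∀ (r l : Fin n → ℤ), ∀ h ∈ ℋ (r, l),
      Coalgebra.comul (R := ℂ) h ∈
        ⨆ s : Fin n → ℤ,
          LinearMap.range (TensorProduct.map (ℋ (r, s)).subtype (ℋ (s, l)).subtype))
    -- (iii) the counit vanishes off the "diagonal" part of the bigrading
    (hε : ∀ (r l : Fin n → ℤ), r ≠ l → ∀ h ∈ ℋ (r, l),
      Coalgebra.counit (R := ℂ) h = (0 : ℂ))
    -- (iv) the antipode maps `H_{(r,l)}` into `H_{(-l,-r)}`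
    (hS : ∀ (r l : Fin n → ℤ), ∀ h ∈ ℋ (r, l),
      HopfAlgebra.antipode (R := ℂ) h ∈ ℋ (-l, -r))
    -- the coaction of `H` on `A`, a comodule algebra structure
    (δ : A →ₐ[ℂ] A ⊗[ℂ] H)
    (hcoassoc : ∀ a : A,
      (TensorProduct.map LinearMap.id (Coalgebra.comul (R := ℂ) (A := H))) (δ a)
        = (TensorProduct.assoc ℂ A H H) ((TensorProduct.map δ.toLinearMap LinearMap.id) (δ a)))
    (hcounit : ∀ a : A,
      (TensorProduct.rid ℂ A)
        ((TensorProduct.map LinearMap.id (Coalgebra.counit (R := ℂ) (A := H))) (δ a)) = a)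
    -- `δ(A_{(r,l)}) ⊆ ⊕_s A_{(r,s)} ⊗ H_{(s,l)}`
    (hδgrad : ∀ (r l : Fin n → ℤ), ∀ a ∈ 𝒜 (r, l),
      δ a ∈ ⨆ s : Fin n → ℤ,
        LinearMap.range (TensorProduct.map (𝒜 (r, s)).subtype (ℋ (s, l)).subtype))
    -- the extension is Hopf--Galois
    (hker : galRel δ ≤ LinearMap.ker (chi0 δ))
    (hGal : Function.Bijective ((galRel δ).liftQ (chi0 δ) hker))
    -- a lift of the translation map `τ`
    (τ0 : H →ₗ[ℂ] A ⊗[ℂ] A)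
    (hτ : ∀ h : H, chi0 δ (τ0 h) = (1 : A) ⊗ₜ[ℂ] h) :
    ∀ (r l : Fin n → ℤ), ∀ h ∈ ℋ (r, l),
      (galRel δ).mkQ (τ0 h) ∈
        Submodule.map (galRel δ).mkQ
          (⨆ p : Fin n → ℤ,
            LinearMap.range
              (TensorProduct.map (𝒜 (-p, -r)).subtype (𝒜 (p, l)).subtype)) := by
  intro r l h hh
  let deg : (Fin n → ℤ) × (Fin n → ℤ) → (Fin n → ℤ) × (Fin n → ℤ) →
      (Fin n → ℤ) × (Fin n → ℤ) × (Fin n → ℤ) := fun i j => (i.1 + j.1, i.2, j.2)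
  let t : (Fin n → ℤ) × (Fin n → ℤ) × (Fin n → ℤ) := (0, -r, l)
  have hmem : ∀ x : A ⊗[ℂ] A, degreeComponents 𝒜 𝒜 deg x t ∈ ⨆ p : Fin n → ℤ,
      LinearMap.range
        (TensorProduct.map (𝒜 (-p, -r)).subtype (𝒜 (p, l)).subtype) := by
    intro x
    induction x using TensorProduct.homogeneous_induction 𝒜 𝒜 with
    | zero => simp
    | add x y hx hy => simpa using add_mem hx hy
    | tmul i j a ha a' ha' =>
      rw [degreeComponents_tmul 𝒜 𝒜 _ ha ha', Finsupp.single_apply]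
      split_ifs with hd
      · obtain ⟨i₁, i₂⟩ := i
        obtain ⟨p, j₂⟩ := j
        simp only [deg, t, Prod.mk.injEq] at hd
        obtain ⟨h₁, rfl, rfl⟩ := hd
        obtain rfl := eq_neg_of_add_eq_zero_left h₁
        exact Submodule.mem_iSup_of_mem p ⟨⟨a, ha⟩ ⊗ₜ ⟨a', ha'⟩, rfl⟩
      · exact zero_mem _
  have hchi : ∀ x : A ⊗[ℂ] A, chi0 δ (degreeComponents 𝒜 𝒜 deg x t) =
      degreeComponents 𝒜 ℋ (fun i j => (i.1, i.2 - j.1, j.2)) (chi0 δ x) t := by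
    intro x
    induction x using TensorProduct.homogeneous_induction 𝒜 𝒜 with
    | zero => simp
    | add x y hx hy => simp [hx, hy]
    | tmul i j a ha a' ha' =>
      rw [degreeComponents_tmul 𝒜 𝒜 _ ha ha',
        degreeComponents_chi0_tmul ℋ 𝒜 δ hδgrad ha ha', Finsupp.single_apply,
        Finsupp.single_apply, apply_ite (chi0 δ), map_zero]
  refine ⟨degreeComponents 𝒜 𝒜 deg (τ0 h) t, hmem _, hGal.injective ?_⟩
  have h_one : (1 : A) ∈ 𝒜 0 := SetLike.one_mem_graded 𝒜
  simp only [Submodule.mkQ_apply, Submodule.liftQ_apply]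
  rw [hchi, hτ, degreeComponents_tmul 𝒜 ℋ _ h_one hh]
  simp [t]

end
end

section
/- Let (A, H) be a Hopf–Galois extension in the bigraded Scenario II setting, with deformation (A_Θ, H_Θ). Then the coinvariants of the deformed diagonal coaction δ^{A⊗_ΘA}(a⊗ã) = a₍₀₎⊗ã₍₀₎⊗(a₍₁₎ ·_Θ ã₍₁₎) coincide, as a subspace of A⊗A, with the coinvariants of the undeformed diagonal coaction: (A_Θ⊗A_Θ)^{co H_Θ} = (A⊗A)^{coH}; moreover this subspace is closed under the deformed product (x⊗y) •_Θ (x̃⊗ỹ) := (x ·_Θ x̃) ⊗ (ỹ ·_Θ y). -/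
/- Statement 14 (Scenario II): For a bigraded Hopf--Galois extension (A,H) with
deformation (A_Θ, H_Θ), the coinvariants of the deformed diagonal coaction on A ⊗ A
coincide with the coinvariants of the undeformed diagonal coaction, and this common
subspace is closed under the deformed product (x⊗y) •_Θ (x̃⊗ỹ) = (x·_Θx̃) ⊗ (ỹ·_Θy). -/

open TensorProduct DirectSum

noncomputable section

/-- The phase factor `λ_θ(r,l) = exp(πi⟨θr,l⟩)`. -/
def phase {n : ℕ} (θ : Matrix (Fin n) (Fin n) ℝ) (r l : Fin n → ℤ) : ℂ :=
  Complex.exp ((Real.pi : ℂ) * Complex.I * ∑ j, ∑ k, (θ j k : ℂ) * (r k : ℂ) * (l j : ℂ))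

/-- The phase factor for the matrix `Θ = diag(θ, -θ)` on the bigrading:
`λ_Θ((r₁,r₂),(l₁,l₂)) = λ_θ(r₁,l₁)·λ_{-θ}(r₂,l₂)`. -/
def phaseTheta {n : ℕ} (θ : Matrix (Fin n) (Fin n) ℝ)
    (r l : (Fin n → ℤ) × (Fin n → ℤ)) : ℂ :=
  phase θ r.1 l.1 * phase (-θ) r.2 l.2

/-- The deformation of the product of a graded algebra by a "bi-character" `c`:
the bilinear extension of `a_r ⊗ ã_l ↦ c r l • (a_r * ã_l)` on homogeneous elements. -/
def defMul {ι : Type} [DecidableEq ι] {A : Type} [Ring A] [Algebra ℂ A]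
    (𝒜 : ι → Submodule ℂ A) [DirectSum.Decomposition 𝒜] (c : ι → ι → ℂ) :
    A →ₗ[ℂ] A →ₗ[ℂ] A :=
  let bil : (⨁ r, ↥(𝒜 r)) →ₗ[ℂ] (⨁ l, ↥(𝒜 l)) →ₗ[ℂ] A :=
    DirectSum.toModule ℂ ι _ (fun r =>
      (DirectSum.toModule ℂ ι (↥(𝒜 r) →ₗ[ℂ] A) (fun l =>
        (c r l • ((LinearMap.mul ℂ A).compl₁₂ (𝒜 r).subtype (𝒜 l).subtype)).flip)).flip)
  let dec : A →ₗ[ℂ] ⨁ r, ↥(𝒜 r) := (DirectSum.decomposeLinearEquiv 𝒜).toLinearMap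
  (bil ∘ₗ dec).compl₂ dec

variable {H A : Type} [Ring H] [HopfAlgebra ℂ H] [Ring A] [Algebra ℂ A]

/-- The diagonal coaction on `A ⊗ A` for a bilinear product `mH` on `H`:
`a ⊗ ã ↦ a₍₀₎ ⊗ ã₍₀₎ ⊗ mH(a₍₁₎, ã₍₁₎)`. -/
def diagCoactionOf (δ : A →ₐ[ℂ] A ⊗[ℂ] H) (mH : H →ₗ[ℂ] H →ₗ[ℂ] H) :
    A ⊗[ℂ] A →ₗ[ℂ] (A ⊗[ℂ] A) ⊗[ℂ] H :=
  (TensorProduct.map LinearMap.id (TensorProduct.lift mH)) ∘ₗ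
    (TensorProduct.tensorTensorTensorComm ℂ A H A H).toLinearMap ∘ₗ
      (TensorProduct.map δ.toLinearMap δ.toLinearMap)

section Phase

variable {n : ℕ} (θ : Matrix (Fin n) (Fin n) ℝ)

theorem phase_ne_zero (r l : Fin n → ℤ) : phase θ r l ≠ 0 := Complex.exp_ne_zero _

theorem phase_add_left (r r' l : Fin n → ℤ) :
    phase θ (r + r') l = phase θ r l * phase θ r' l := by
  simp only [phase, ← Complex.exp_add, ← mul_add, ← Finset.sum_add_distrib]
  congr 2
  refine Finset.sum_congr rfl fun j _ => Finset.sum_congr rfl fun k _ => ?_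
  push_cast [Pi.add_apply]
  ring

theorem phase_add_right (r l l' : Fin n → ℤ) :
    phase θ r (l + l') = phase θ r l * phase θ r l' := by
  simp only [phase, ← Complex.exp_add, ← mul_add, ← Finset.sum_add_distrib]
  congr 2
  refine Finset.sum_congr rfl fun j _ => Finset.sum_congr rfl fun k _ => ?_
  push_cast [Pi.add_apply]
  ring

@[simp]
theorem phase_zero_left (l : Fin n → ℤ) : phase θ 0 l = 1 := by simp [phase]

@[simp]
theorem phase_zero_right (r : Fin n → ℤ) : phase θ r 0 = 1 := by simp [phase]

theorem phase_neg_mul_phase (r l : Fin n → ℤ) : phase (-θ) r l * phase θ r l = 1 := by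
  simp only [phase, ← Complex.exp_add, ← mul_add, ← Finset.sum_add_distrib]
  simp

theorem phase_self {θ : Matrix (Fin n) (Fin n) ℝ} (hθ : ∀ j k, θ k j = -θ j k)
    (r : Fin n → ℤ) : phase θ r r = 1 := by
  have h : ∑ j, ∑ k, (θ j k : ℂ) * (r k : ℂ) * (r j : ℂ) = 0 := by
    refine self_eq_neg.mp ?_
    conv_lhs => rw [Finset.sum_comm]
    rw [← Finset.sum_neg_distrib]
    refine Finset.sum_congr rfl fun j _ => ?_
    rw [← Finset.sum_neg_distrib]
    refine Finset.sum_congr rfl fun k _ => ?_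
    rw [hθ j k]
    push_cast
    ring
  simp [phase, h]

theorem phase_eq_one_of_add_eq_zero {θ : Matrix (Fin n) (Fin n) ℝ}
    (hθ : ∀ j k, θ k j = -θ j k) {r l : Fin n → ℤ} (h : r + l = 0) : phase θ r l = 1 := by
  have := phase_add_right θ r r l
  rwa [h, phase_zero_right, phase_self hθ, one_mul, eq_comm] at this

theorem phaseTheta_add_left (r r' l : (Fin n → ℤ) × (Fin n → ℤ)) :
    phaseTheta θ (r + r') l = phaseTheta θ r l * phaseTheta θ r' l := by
  simp only [phaseTheta, Prod.fst_add, Prod.snd_add, phase_add_left]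
  ring

theorem phaseTheta_add_right (r l l' : (Fin n → ℤ) × (Fin n → ℤ)) :
    phaseTheta θ r (l + l') = phaseTheta θ r l * phaseTheta θ r l' := by
  simp only [phaseTheta, Prod.fst_add, Prod.snd_add, phase_add_right]
  ring

end Phase

section Graded

variable {ι M R : Type} [DecidableEq ι] [AddCommGroup M] [Module ℂ M] [Ring R] [Algebra ℂ R]

theorem linearMap_ext_of_homogeneous (𝒜 : ι → Submodule ℂ R) [Decomposition 𝒜]
    {f g : R →ₗ[ℂ] M} (h : ∀ i, ∀ a ∈ 𝒜 i, f a = g a) : f = g := by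
  ext a
  induction a using Decomposition.inductionOn 𝒜 with
  | zero => simp
  | homogeneous a => exact h _ a a.2
  | add a b ha hb => simp [ha, hb]

theorem tensor_ext_of_homogeneous (𝒜 : ι → Submodule ℂ R) [Decomposition 𝒜]
    {f g : R ⊗[ℂ] R →ₗ[ℂ] M}
    (h : ∀ i j, ∀ a ∈ 𝒜 i, ∀ b ∈ 𝒜 j, f (a ⊗ₜ b) = g (a ⊗ₜ b)) : f = g := by
  refine TensorProduct.ext (linearMap_ext_of_homogeneous 𝒜 fun i a ha =>
    linearMap_ext_of_homogeneous 𝒜 fun j b hb => ?_)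
  exact h i j a ha b hb

theorem decomposeLinearEquiv_of_mem (𝒜 : ι → Submodule ℂ R) [Decomposition 𝒜] {i : ι}
    {a : R} (ha : a ∈ 𝒜 i) :
    decomposeLinearEquiv 𝒜 a = lof ℂ ι (fun i => 𝒜 i) i ⟨a, ha⟩ :=
  decompose_of_mem 𝒜 ha

theorem defMul_of_mem (𝒜 : ι → Submodule ℂ R) [Decomposition 𝒜] (c : ι → ι → ℂ) {i j : ι}
    {a b : R} (ha : a ∈ 𝒜 i) (hb : b ∈ 𝒜 j) : defMul 𝒜 c a b = c i j • (a * b) := by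
  simp [defMul, decomposeLinearEquiv_of_mem 𝒜 ha, decomposeLinearEquiv_of_mem 𝒜 hb]

/-- The operator acting on the degree `i` component by the scalar `f i`. -/
def scaleGraded (𝒜 : ι → Submodule ℂ R) [Decomposition 𝒜] (f : ι → ℂ) : R →ₗ[ℂ] R :=
  toModule ℂ ι R (fun i => f i • (𝒜 i).subtype) ∘ₗ (decomposeLinearEquiv 𝒜).toLinearMap

theorem scaleGraded_of_mem (𝒜 : ι → Submodule ℂ R) [Decomposition 𝒜] (f : ι → ℂ) {i : ι}
    {a : R} (ha : a ∈ 𝒜 i) : scaleGraded 𝒜 f a = f i • a := by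
  simp [scaleGraded, decomposeLinearEquiv_of_mem 𝒜 ha]

/-- The operator on `R ⊗ R` acting on `R_i ⊗ R_j` by the scalar `c i j`. -/
def scaleTensor (𝒜 : ι → Submodule ℂ R) [Decomposition 𝒜] (c : ι → ι → ℂ) :
    R ⊗[ℂ] R →ₗ[ℂ] R ⊗[ℂ] R :=
  TensorProduct.lift
    (toModule ℂ ι (R →ₗ[ℂ] R ⊗[ℂ] R)
      (fun i => (TensorProduct.mk ℂ R R).compl₂ (scaleGraded 𝒜 (c i)) ∘ₗ (𝒜 i).subtype) ∘ₗ
        (decomposeLinearEquiv 𝒜).toLinearMap)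

theorem scaleTensor_of_mem (𝒜 : ι → Submodule ℂ R) [Decomposition 𝒜] (c : ι → ι → ℂ)
    {i j : ι} {a b : R} (ha : a ∈ 𝒜 i) (hb : b ∈ 𝒜 j) :
    scaleTensor 𝒜 c (a ⊗ₜ b) = c i j • (a ⊗ₜ[ℂ] b) := by
  simp [scaleTensor, decomposeLinearEquiv_of_mem 𝒜 ha, scaleGraded_of_mem 𝒜 _ hb]

theorem scaleTensor_scaleTensor (𝒜 : ι → Submodule ℂ R) [Decomposition 𝒜]
    (c d : ι → ι → ℂ) (x : R ⊗[ℂ] R) :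
    scaleTensor 𝒜 c (scaleTensor 𝒜 d x) = scaleTensor 𝒜 (fun i j => c i j * d i j) x := by
  have : scaleTensor 𝒜 c ∘ₗ scaleTensor 𝒜 d = scaleTensor 𝒜 (fun i j => c i j * d i j) := by
    refine tensor_ext_of_homogeneous 𝒜 fun i j a ha b hb => ?_
    simp [scaleTensor_of_mem 𝒜 _ ha hb, smul_smul, mul_comm]
  exact LinearMap.congr_fun this x

theorem scaleTensor_one (𝒜 : ι → Submodule ℂ R) [Decomposition 𝒜] (x : R ⊗[ℂ] R) :
    scaleTensor 𝒜 (fun _ _ => 1) x = x := by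
  have : scaleTensor 𝒜 (fun _ _ => 1) = LinearMap.id := by
    refine tensor_ext_of_homogeneous 𝒜 fun i j a ha b hb => ?_
    simp [scaleTensor_of_mem 𝒜 _ ha hb]
  exact LinearMap.congr_fun this x

variable [AddCommMonoid ι] (𝒜 : ι → Submodule ℂ R) [GradedAlgebra 𝒜] {c : ι → ι → ℂ}

theorem defMul_mem {i j : ι} {a b : R} (ha : a ∈ 𝒜 i) (hb : b ∈ 𝒜 j) :
    defMul 𝒜 c a b ∈ 𝒜 (i + j) := by
  rw [defMul_of_mem 𝒜 c ha hb]
  exact Submodule.smul_mem _ _ (SetLike.mul_mem_graded ha hb)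

theorem defMul_assoc (hl : ∀ i j k, c (i + j) k = c i k * c j k)
    (hr : ∀ i j k, c i (j + k) = c i j * c i k) (x y z : R) :
    defMul 𝒜 c (defMul 𝒜 c x y) z = defMul 𝒜 c x (defMul 𝒜 c y z) := by
  induction x using Decomposition.inductionOn 𝒜 with
  | zero => simp
  | add a b ha hb => simp [ha, hb]
  | @homogeneous i a =>
  induction y using Decomposition.inductionOn 𝒜 with
  | zero => simp
  | add a b ha hb => simp [ha, hb]
  | @homogeneous j b =>
  induction z using Decomposition.inductionOn 𝒜 with
  | zero => simp
  | add a b ha hb => simp [ha, hb]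
  | @homogeneous k d =>
  have hab := SetLike.mul_mem_graded a.2 b.2
  have hbd := SetLike.mul_mem_graded b.2 d.2
  simp only [defMul_of_mem 𝒜 c a.2 b.2, defMul_of_mem 𝒜 c b.2 d.2, map_smul,
    LinearMap.smul_apply, defMul_of_mem 𝒜 c hab d.2, defMul_of_mem 𝒜 c a.2 hbd, smul_smul,
    hl, hr, mul_assoc]
  congr 1
  ring

theorem defMul_one (hc : ∀ i, c i 0 = 1) (x : R) : defMul 𝒜 c x 1 = x := by
  induction x using Decomposition.inductionOn 𝒜 with
  | zero => simp
  | add a b ha hb => simp [ha, hb]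
  | @homogeneous i a => simp [defMul_of_mem 𝒜 c a.2 (SetLike.one_mem_graded 𝒜), hc]

end Graded

section Coaction

variable {n : ℕ} {M : Type} [AddCommGroup M] [Module ℂ M]
  (ℋ : (Fin n → ℤ) × (Fin n → ℤ) → Submodule ℂ H)
  (𝒜 : (Fin n → ℤ) × (Fin n → ℤ) → Submodule ℂ A)

theorem eqOn_iSup_range_map {r l : Fin n → ℤ} {f g : A ⊗[ℂ] H →ₗ[ℂ] M}
    (h : ∀ s, ∀ p ∈ 𝒜 (r, s), ∀ u ∈ ℋ (s, l), f (p ⊗ₜ u) = g (p ⊗ₜ u))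
    {x : A ⊗[ℂ] H}
    (hx : x ∈ ⨆ s : Fin n → ℤ,
      LinearMap.range (TensorProduct.map (𝒜 (r, s)).subtype (ℋ (s, l)).subtype)) :
    f x = g x := by
  refine (iSup_le fun s => ?_ : _ ≤ LinearMap.eqLocus f g) hx
  rw [LinearMap.range_le_iff_comap, eq_top_iff]
  intro y _
  induction y using TensorProduct.induction_on with
  | zero => exact Submodule.zero_mem _
  | add y z hy hz => exact Submodule.add_mem _ (hy trivial) (hz trivial)
  | tmul p u => exact h s p p.2 u u.2

theorem eqOn_iSup_range_map₂ {r l r' l' : Fin n → ℤ}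
    {F G : A ⊗[ℂ] H →ₗ[ℂ] A ⊗[ℂ] H →ₗ[ℂ] M}
    (h : ∀ s s', ∀ p ∈ 𝒜 (r, s), ∀ u ∈ ℋ (s, l), ∀ q ∈ 𝒜 (r', s'), ∀ v ∈ ℋ (s', l'),
      F (p ⊗ₜ u) (q ⊗ₜ v) = G (p ⊗ₜ u) (q ⊗ₜ v))
    {x y : A ⊗[ℂ] H}
    (hx : x ∈ ⨆ s : Fin n → ℤ,
      LinearMap.range (TensorProduct.map (𝒜 (r, s)).subtype (ℋ (s, l)).subtype))
    (hy : y ∈ ⨆ s : Fin n → ℤ,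
      LinearMap.range (TensorProduct.map (𝒜 (r', s)).subtype (ℋ (s, l')).subtype)) :
    F x y = G x y := by
  refine eqOn_iSup_range_map (f := F.flip y) (g := G.flip y) ℋ 𝒜 (fun s p hp u hu => ?_) hx
  exact eqOn_iSup_range_map ℋ 𝒜 (fun s' q hq v hv => h s s' p hp u hu q hq v hv) hy

/-- The bilinear map `(a ⊗ u, ã ⊗ v) ↦ a ⊗ ã ⊗ mH(u, v)`. -/
def diagBilin (A : Type) [Ring A] [Algebra ℂ A] (mH : H →ₗ[ℂ] H →ₗ[ℂ] H) :
    A ⊗[ℂ] H →ₗ[ℂ] A ⊗[ℂ] H →ₗ[ℂ] (A ⊗[ℂ] A) ⊗[ℂ] H :=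
  TensorProduct.map₂ (TensorProduct.mk ℂ A A) mH

theorem diagCoactionOf_tmul (δ : A →ₐ[ℂ] A ⊗[ℂ] H) (mH : H →ₗ[ℂ] H →ₗ[ℂ] H) (a b : A) :
    diagCoactionOf δ mH (a ⊗ₜ b) = diagBilin A mH (δ a) (δ b) := by
  simp only [diagCoactionOf, diagBilin, LinearMap.comp_apply, TensorProduct.map_tmul,
    AlgHom.toLinearMap_apply, LinearEquiv.coe_coe]
  generalize δ a = x
  generalize δ b = y
  induction x using TensorProduct.induction_on with
  | zero => simp
  | add x z hx hz => simp only [TensorProduct.add_tmul, map_add, hx, hz, LinearMap.add_apply]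
  | tmul p u =>
    induction y using TensorProduct.induction_on with
    | zero => simp
    | add x z hx hz => simp only [TensorProduct.tmul_add, map_add, hx, hz]
    | tmul q v => simp

variable [GradedAlgebra ℋ] [GradedAlgebra 𝒜] {δ : A →ₐ[ℂ] A ⊗[ℂ] H}

theorem tmul_one_injective {x y : M} (h : x ⊗ₜ[ℂ] (1 : H) = y ⊗ₜ[ℂ] (1 : H)) : x = y := by
  have := congrArg (TensorProduct.rid ℂ M ∘
    TensorProduct.map LinearMap.id (Coalgebra.counit (R := ℂ) (A := H))) h
  simpa using this

theorem diagCoactionOf_scaleTensor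
    (hδgrad : ∀ (r l : Fin n → ℤ), ∀ a ∈ 𝒜 (r, l),
      δ a ∈ ⨆ s : Fin n → ℤ,
        LinearMap.range (TensorProduct.map (𝒜 (r, s)).subtype (ℋ (s, l)).subtype))
    (θ : Matrix (Fin n) (Fin n) ℝ) (x : A ⊗[ℂ] A) :
    diagCoactionOf δ (defMul ℋ (phaseTheta θ))
        (scaleTensor 𝒜 (fun i j => phase θ i.2 j.2) x) =
      TensorProduct.map (scaleTensor 𝒜 (fun i j => phase θ i.2 j.2)) LinearMap.id
        (diagCoactionOf δ (LinearMap.mul ℂ H) x) := by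
  refine LinearMap.congr_fun (f := diagCoactionOf δ (defMul ℋ (phaseTheta θ)) ∘ₗ
    scaleTensor 𝒜 (fun i j => phase θ i.2 j.2)) (g :=
    TensorProduct.map (scaleTensor 𝒜 (fun i j => phase θ i.2 j.2)) LinearMap.id ∘ₗ
      diagCoactionOf δ (LinearMap.mul ℂ H))
    (tensor_ext_of_homogeneous 𝒜 ?_) x
  rintro ⟨r, l⟩ ⟨r', l'⟩ a ha b hb
  simp only [LinearMap.comp_apply, scaleTensor_of_mem 𝒜 _ ha hb, map_smul, diagCoactionOf_tmul]
  refine eqOn_iSup_range_map₂ ℋ 𝒜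
    (F := phase θ l l' • diagBilin A (defMul ℋ (phaseTheta θ)))
    (G := (diagBilin A (LinearMap.mul ℂ H)).compr₂
      (TensorProduct.map (scaleTensor 𝒜 (fun i j => phase θ i.2 j.2)) LinearMap.id))
    ?_ (hδgrad _ _ a ha) (hδgrad _ _ b hb)
  intro s s' p hp u hu q hq v hv
  have h := phase_neg_mul_phase θ l l'
  simp only [diagBilin, LinearMap.smul_apply, TensorProduct.map₂_apply_tmul,
    LinearMap.compr₂_apply, TensorProduct.map_tmul, TensorProduct.mk_apply,
    defMul_of_mem ℋ _ hu hv, scaleTensor_of_mem 𝒜 _ hp hq, LinearMap.id_apply,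
    LinearMap.mul_apply', TensorProduct.tmul_smul, ← TensorProduct.smul_tmul', smul_smul]
  congr 1
  simp only [phaseTheta]
  linear_combination phase θ s s' * h

theorem scaleTensor_eq_self_of_coinvariant
    (hδgrad : ∀ (r l : Fin n → ℤ), ∀ a ∈ 𝒜 (r, l),
      δ a ∈ ⨆ s : Fin n → ℤ,
        LinearMap.range (TensorProduct.map (𝒜 (r, s)).subtype (ℋ (s, l)).subtype))
    {mH : H →ₗ[ℂ] H →ₗ[ℂ] H}
    (hm : ∀ i j, ∀ u ∈ ℋ i, ∀ v ∈ ℋ j, mH u v ∈ ℋ (i + j))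
    {x : A ⊗[ℂ] A} (hx : diagCoactionOf δ mH x = x ⊗ₜ[ℂ] (1 : H))
    {c : (Fin n → ℤ) × (Fin n → ℤ) → (Fin n → ℤ) × (Fin n → ℤ) → ℂ}
    (hc : ∀ i j, i.2 + j.2 = 0 → c i j = 1) :
    scaleTensor 𝒜 c x = x := by
  set w : (Fin n → ℤ) × (Fin n → ℤ) → (Fin n → ℤ) × (Fin n → ℤ) → ℂ :=
    fun i j => if i.2 + j.2 = 0 then 1 else 0 with hw
  set f : (Fin n → ℤ) × (Fin n → ℤ) → ℂ := fun i => if i.1 = 0 then 1 else 0 with hf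
  have key : TensorProduct.map (scaleTensor 𝒜 w) LinearMap.id ∘ₗ diagCoactionOf δ mH =
      TensorProduct.map LinearMap.id (scaleGraded ℋ f) ∘ₗ diagCoactionOf δ mH := by
    refine tensor_ext_of_homogeneous 𝒜 ?_
    rintro ⟨r, l⟩ ⟨r', l'⟩ a ha b hb
    simp only [LinearMap.comp_apply, diagCoactionOf_tmul]
    refine eqOn_iSup_range_map₂ ℋ 𝒜
      (F := (diagBilin A mH).compr₂ (TensorProduct.map (scaleTensor 𝒜 w) LinearMap.id))
      (G := (diagBilin A mH).compr₂ (TensorProduct.map LinearMap.id (scaleGraded ℋ f)))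
      ?_ (hδgrad _ _ a ha) (hδgrad _ _ b hb)
    intro s s' p hp u hu q hq v hv
    by_cases h : s + s' = 0 <;> simp [diagBilin, scaleTensor_of_mem 𝒜 _ hp hq,
      scaleGraded_of_mem ℋ _ (hm _ _ u hu v hv), hw, hf, h]
  have hwx : scaleTensor 𝒜 w x = x := by
    have h := LinearMap.congr_fun key x
    simp only [LinearMap.comp_apply, hx, TensorProduct.map_tmul, LinearMap.id_apply,
      scaleGraded_of_mem ℋ f (SetLike.one_mem_graded ℋ)] at h
    exact tmul_one_injective (H := H) (by simpa [hf] using h)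
  have hcw : (fun i j => c i j * w i j) = w := by
    funext i j
    by_cases h : i.2 + j.2 = 0 <;> simp [hw, h, hc]
  rw [← hwx, scaleTensor_scaleTensor, hcw]

theorem coaction_defMul
    (hδgrad : ∀ (r l : Fin n → ℤ), ∀ a ∈ 𝒜 (r, l),
      δ a ∈ ⨆ s : Fin n → ℤ,
        LinearMap.range (TensorProduct.map (𝒜 (r, s)).subtype (ℋ (s, l)).subtype))
    (θ : Matrix (Fin n) (Fin n) ℝ) (a b : A) :
    δ (defMul 𝒜 (phaseTheta θ) a b) =
      TensorProduct.map₂ (defMul 𝒜 (phaseTheta θ)) (defMul ℋ (phaseTheta θ)) (δ a) (δ b) := by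
  induction a using Decomposition.inductionOn 𝒜 with
  | zero => simp
  | add a b ha hb => simp only [map_add, LinearMap.add_apply, ha, hb]
  | @homogeneous i a =>
  induction b using Decomposition.inductionOn 𝒜 with
  | zero => simp
  | add a b ha hb => simp only [map_add, ha, hb]
  | @homogeneous j b =>
  obtain ⟨r, l⟩ := i
  obtain ⟨r', l'⟩ := j
  rw [defMul_of_mem 𝒜 _ a.2 b.2, map_smul, map_mul]
  refine eqOn_iSup_range_map₂ ℋ 𝒜
    (F := phaseTheta θ (r, l) (r', l') • LinearMap.mul ℂ (A ⊗[ℂ] H))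
    (G := TensorProduct.map₂ (defMul 𝒜 (phaseTheta θ)) (defMul ℋ (phaseTheta θ)))
    ?_ (hδgrad _ _ a a.2) (hδgrad _ _ b b.2)
  intro s s' p hp u hu q hq v hv
  have h := phase_neg_mul_phase θ s s'
  change phaseTheta θ (r, l) (r', l') • ((p ⊗ₜ[ℂ] u) * (q ⊗ₜ[ℂ] v)) =
    TensorProduct.map₂ (defMul 𝒜 (phaseTheta θ)) (defMul ℋ (phaseTheta θ)) (p ⊗ₜ u) (q ⊗ₜ v)
  rw [TensorProduct.map₂_apply_tmul, TensorProduct.map_tmul, Algebra.TensorProduct.tmul_mul_tmul,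
    defMul_of_mem ℋ _ hu hv, defMul_of_mem 𝒜 _ hp hq, TensorProduct.tmul_smul,
    ← TensorProduct.smul_tmul', smul_smul]
  congr 1
  simp only [phaseTheta]
  linear_combination -(phase θ r r' * phase (-θ) l l') * h

theorem diagCoactionOf_map₂ {mA : A →ₗ[ℂ] A →ₗ[ℂ] A} {mH : H →ₗ[ℂ] H →ₗ[ℂ] H}
    (hassoc : ∀ u v w, mH (mH u v) w = mH u (mH v w)) (hone : ∀ u, mH u 1 = u)
    (hδ : ∀ a b, δ (mA a b) = TensorProduct.map₂ mA mH (δ a) (δ b)) {x y : A ⊗[ℂ] A}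
    (hx : diagCoactionOf δ mH x = x ⊗ₜ[ℂ] (1 : H))
    (hy : diagCoactionOf δ mH y = y ⊗ₜ[ℂ] (1 : H)) :
    diagCoactionOf δ mH (TensorProduct.map₂ mA mA.flip x y) =
      TensorProduct.map₂ mA mA.flip x y ⊗ₜ[ℂ] (1 : H) := by
  let N : H ⊗[ℂ] H →ₗ[ℂ] H →ₗ[ℂ] H :=
    TensorProduct.lift ((LinearMap.llcomp ℂ H H H).flip.compl₁₂ mH mH.flip)
  have hN (u v w : H) : N (u ⊗ₜ v) w = mH (mH u w) v := rfl
  let C : A ⊗[ℂ] A →ₗ[ℂ] (A ⊗[ℂ] A) ⊗[ℂ] (H ⊗[ℂ] H) :=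
    (TensorProduct.tensorTensorTensorComm ℂ A H A H).toLinearMap ∘ₗ
      TensorProduct.map δ.toLinearMap δ.toLinearMap
  let P := TensorProduct.map₂ mA mA.flip
  have hD (z : A ⊗[ℂ] A) : diagCoactionOf δ mH z =
      TensorProduct.map LinearMap.id (TensorProduct.lift mH) (C z) := rfl
  have hmul : (P.compr₂ (diagCoactionOf δ mH)) =
      (TensorProduct.map₂ P N).compl₁₂ C (diagCoactionOf δ mH) := by
    refine TensorProduct.ext' fun a a' => TensorProduct.ext' fun b b' => ?_
    simp only [P, C, LinearMap.compr₂_apply, LinearMap.compl₁₂_apply, diagCoactionOf_tmul,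
      TensorProduct.map₂_apply_tmul, LinearMap.flip_apply, hδ, LinearMap.comp_apply,
      TensorProduct.map_tmul, AlgHom.toLinearMap_apply, LinearEquiv.coe_coe]
    generalize δ a = p
    generalize δ a' = p'
    generalize δ b = q
    generalize δ b' = q'
    induction p using TensorProduct.induction_on with
    | zero => simp
    | add z w hz hw =>
      simp only [TensorProduct.add_tmul, map_add, LinearMap.add_apply, hz, hw]
    | tmul _ _ =>
    induction p' using TensorProduct.induction_on with
    | zero => simp
    | add z w hz hw =>
      simp only [TensorProduct.tmul_add, map_add, LinearMap.add_apply, hz, hw]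
    | tmul _ _ =>
    induction q using TensorProduct.induction_on with
    | zero => simp
    | add z w hz hw =>
      simp only [map_add, LinearMap.add_apply, hz, hw]
    | tmul _ _ =>
    induction q' using TensorProduct.induction_on with
    | zero => simp
    | add z w hz hw =>
      simp only [map_add, LinearMap.add_apply, hz, hw]
    | tmul _ _ =>
    simp [diagBilin, hN, hassoc]
  have hunit (z : (A ⊗[ℂ] A) ⊗[ℂ] (H ⊗[ℂ] H)) : TensorProduct.map₂ P N z (y ⊗ₜ[ℂ] (1 : H)) =
      TensorProduct.map (P.flip y) LinearMap.id
        (TensorProduct.map LinearMap.id (TensorProduct.lift mH) z) := by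
    induction z using TensorProduct.induction_on with
    | zero => simp
    | add z w hz hw => simp only [map_add, LinearMap.add_apply, hz, hw]
    | tmul p q =>
      induction q using TensorProduct.induction_on with
      | zero => simp
      | add z w hz hw => simp only [TensorProduct.tmul_add, map_add, LinearMap.add_apply, hz, hw]
      | tmul u v => simp [hN, hone]
  have h : diagCoactionOf δ mH (P x y) = TensorProduct.map₂ P N (C x) (diagCoactionOf δ mH y) :=
    LinearMap.congr_fun₂ hmul x y
  rw [hy, hunit, ← hD, hx] at h
  exact h

end Coaction

theorem deformed_diagonal_coinvariants {n : ℕ} (θ : Matrix (Fin n) (Fin n) ℝ)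
    (hθ : ∀ j k, θ k j = - θ j k)
    (ℋ : (Fin n → ℤ) × (Fin n → ℤ) → Submodule ℂ H) [GradedAlgebra ℋ]
    (𝒜 : (Fin n → ℤ) × (Fin n → ℤ) → Submodule ℂ A) [GradedAlgebra 𝒜]
    -- (ii) the coproduct of `H` is compatible with the bigrading
    (hΔ : ∀ (r l : Fin n → ℤ), ∀ h ∈ ℋ (r, l),
      Coalgebra.comul (R := ℂ) h ∈
        ⨆ s : Fin n → ℤ,
          LinearMap.range (TensorProduct.map (ℋ (r, s)).subtype (ℋ (s, l)).subtype))
    -- (iii) the counit vanishes off the "diagonal" part of the bigrading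
    (hε : ∀ (r l : Fin n → ℤ), r ≠ l → ∀ h ∈ ℋ (r, l),
      Coalgebra.counit (R := ℂ) h = (0 : ℂ))
    -- (iv) the antipode maps `H_{(r,l)}` into `H_{(-l,-r)}`
    (hS : ∀ (r l : Fin n → ℤ), ∀ h ∈ ℋ (r, l),
      HopfAlgebra.antipode (R := ℂ) h ∈ ℋ (-l, -r))
    -- the coaction of `H` on `A`, a comodule algebra structure
    (δ : A →ₐ[ℂ] A ⊗[ℂ] H)
    (hcoassoc : ∀ a : A,
      (TensorProduct.map LinearMap.id (Coalgebra.comul (R := ℂ) (A := H))) (δ a)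
        = (TensorProduct.assoc ℂ A H H) ((TensorProduct.map δ.toLinearMap LinearMap.id) (δ a)))
    (hcounit : ∀ a : A,
      (TensorProduct.rid ℂ A)
        ((TensorProduct.map LinearMap.id (Coalgebra.counit (R := ℂ) (A := H))) (δ a)) = a)
    -- `δ(A_{(r,l)}) ⊆ ⊕_s A_{(r,s)} ⊗ H_{(s,l)}`
    (hδgrad : ∀ (r l : Fin n → ℤ), ∀ a ∈ 𝒜 (r, l),
      δ a ∈ ⨆ s : Fin n → ℤ,
        LinearMap.range (TensorProduct.map (𝒜 (r, s)).subtype (ℋ (s, l)).subtype))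
    -- the extension is Hopf--Galois
    (hker : galRel δ ≤ LinearMap.ker (chi0 δ))
    (hGal : Function.Bijective ((galRel δ).liftQ (chi0 δ) hker)) :
    -- the deformed and undeformed diagonal coactions have the same coinvariants
    (∀ x : A ⊗[ℂ] A,
      diagCoactionOf δ (defMul ℋ (phaseTheta θ)) x = x ⊗ₜ[ℂ] (1 : H) ↔
      diagCoactionOf δ (LinearMap.mul ℂ H) x = x ⊗ₜ[ℂ] (1 : H)) ∧
    -- and this subspace is closed under the deformed bialgebroid product `•_Θ`
    (∀ x y : A ⊗[ℂ] A,
      diagCoactionOf δ (defMul ℋ (phaseTheta θ)) x = x ⊗ₜ[ℂ] (1 : H) →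
      diagCoactionOf δ (defMul ℋ (phaseTheta θ)) y = y ⊗ₜ[ℂ] (1 : H) →
      diagCoactionOf δ (defMul ℋ (phaseTheta θ))
          (TensorProduct.map₂ (defMul 𝒜 (phaseTheta θ)) ((defMul 𝒜 (phaseTheta θ)).flip) x y)
        = (TensorProduct.map₂ (defMul 𝒜 (phaseTheta θ)) ((defMul 𝒜 (phaseTheta θ)).flip) x y)
            ⊗ₜ[ℂ] (1 : H)) := by
  have hassoc := defMul_assoc ℋ (phaseTheta_add_left θ) (phaseTheta_add_right θ)
  have hone := defMul_one ℋ (c := phaseTheta θ) fun i => by simp [phaseTheta]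
  refine ⟨fun x => ⟨fun hx => ?_, fun hx => ?_⟩, fun x y hx hy =>
    diagCoactionOf_map₂ hassoc hone (coaction_defMul ℋ 𝒜 hδgrad θ) hx hy⟩
  · have hm (i j) (u : H) (hu : u ∈ ℋ i) (v : H) (hv : v ∈ ℋ j) :
        defMul ℋ (phaseTheta θ) u v ∈ ℋ (i + j) := defMul_mem ℋ hu hv
    have hT := scaleTensor_eq_self_of_coinvariant ℋ 𝒜 hδgrad hm hx
      (c := fun i j => phase θ i.2 j.2) fun i j h => phase_eq_one_of_add_eq_zero hθ h
    have hT' := scaleTensor_eq_self_of_coinvariant ℋ 𝒜 hδgrad hm hx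
      (c := fun i j => (phase θ i.2 j.2)⁻¹) fun i j h => by
        simp [phase_eq_one_of_add_eq_zero hθ h]
    have h := diagCoactionOf_scaleTensor ℋ 𝒜 hδgrad θ x
    rw [hT, hx] at h
    have h' := congrArg
      (TensorProduct.map (scaleTensor 𝒜 fun i j => (phase θ i.2 j.2)⁻¹) LinearMap.id) h
    rw [TensorProduct.map_tmul, hT', LinearMap.id_apply, ← LinearMap.comp_apply,
      ← TensorProduct.map_comp] at h'
    have hid : (scaleTensor 𝒜 fun i j => (phase θ i.2 j.2)⁻¹) ∘ₗ
        (scaleTensor 𝒜 fun i j => phase θ i.2 j.2) = LinearMap.id := by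
      ext1
      ext
      simp [scaleTensor_scaleTensor, phase_ne_zero, scaleTensor_one]
    simpa [hid] using h'.symm
  · have hT := scaleTensor_eq_self_of_coinvariant ℋ 𝒜 hδgrad
      (fun i j u hu v hv => SetLike.mul_mem_graded hu hv) hx
      (c := fun i j => phase θ i.2 j.2) fun i j h => phase_eq_one_of_add_eq_zero hθ h
    have h := diagCoactionOf_scaleTensor ℋ 𝒜 hδgrad θ x
    rwa [hT, hx, TensorProduct.map_tmul, hT, LinearMap.id_apply] at h

end
end
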